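/- arXiv:1712.06805 — 2 statements merged into one kernel-verified Lean document; each statement's English description precedes it below -/
import Mathlib

section
/- The following are equivalent: (i) for every sequence (A_n)_{n≥1} with A_n ∈ 𝒜 there exists a sequence (B_n)_{n≥1} with B_n ∈ 𝒝 such that ‖A_n B_n ⋯ A_1 B_1‖ → 0 as n → ∞ (path-dependent stabilizability); (ii) μ(𝒜,𝒝) < 1. -/
open Filter

/-- The product `A_n B_n ⋯ A_1 B_1` of the first `n` pairs of factors of two
sequences of matrices (the pair with index `i`, `1 ≤ i ≤ n`, being `A (i-1) * B (i-1)`). -/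
def prodAB {N M : ℕ} (A : ℕ → Matrix (Fin N) (Fin M) ℝ)
    (B : ℕ → Matrix (Fin M) (Fin N) ℝ) : ℕ → Matrix (Fin N) (Fin N) ℝ
  | 0 => 1
  | n + 1 => (A n * B n) * prodAB A B n

/-- The product `A_n B_n ⋯ A_1 B_1` for collections of matrices indexed by `Fin n`. -/
def prodABFin {N M n : ℕ} (A : Fin n → Matrix (Fin N) (Fin M) ℝ)
    (B : Fin n → Matrix (Fin M) (Fin N) ℝ) : Matrix (Fin N) (Fin N) ℝ :=
  (List.ofFn fun i => A i * B i).reverse.prod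

/-- `μ_n(𝒜,𝒝)`: the max over all choices `A_1,…,A_n ∈ 𝒜` of the min over all
choices `B_1,…,B_n ∈ 𝒝` of `ν (A_n B_n ⋯ A_1 B_1)`, where `ν` is a norm on
`N×N` matrices. -/
noncomputable def muN {N M : ℕ} (𝒜 : Finset (Matrix (Fin N) (Fin M) ℝ))
    (𝒝 : Finset (Matrix (Fin M) (Fin N) ℝ)) (hA : 𝒜.Nonempty) (hB : 𝒝.Nonempty)
    (ν : Matrix (Fin N) (Fin N) ℝ → ℝ) (n : ℕ) : ℝ :=
  haveI : Nonempty {A // A ∈ 𝒜} := ⟨⟨hA.choose, hA.choose_spec⟩⟩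
  haveI : Nonempty {B // B ∈ 𝒝} := ⟨⟨hB.choose, hB.choose_spec⟩⟩
  Finset.univ.sup' Finset.univ_nonempty fun A : Fin n → {A // A ∈ 𝒜} =>
    Finset.univ.inf' Finset.univ_nonempty fun B : Fin n → {B // B ∈ 𝒝} =>
      ν (prodABFin (fun i => (A i : Matrix (Fin N) (Fin M) ℝ))
          (fun i => (B i : Matrix (Fin M) (Fin N) ℝ)))

/-- `η_n(𝒜,𝒝)`: the min over all choices `B_1,…,B_n ∈ 𝒝` of the max over all
choices `A_1,…,A_n ∈ 𝒜` of `ν (A_n B_n ⋯ A_1 B_1)`, where `ν` is a norm on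
`N×N` matrices. -/
noncomputable def etaN {N M : ℕ} (𝒜 : Finset (Matrix (Fin N) (Fin M) ℝ))
    (𝒝 : Finset (Matrix (Fin M) (Fin N) ℝ)) (hA : 𝒜.Nonempty) (hB : 𝒝.Nonempty)
    (ν : Matrix (Fin N) (Fin N) ℝ → ℝ) (n : ℕ) : ℝ :=
  haveI : Nonempty {A // A ∈ 𝒜} := ⟨⟨hA.choose, hA.choose_spec⟩⟩
  haveI : Nonempty {B // B ∈ 𝒝} := ⟨⟨hB.choose, hB.choose_spec⟩⟩
  Finset.univ.inf' Finset.univ_nonempty fun B : Fin n → {B // B ∈ 𝒝} =>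
    Finset.univ.sup' Finset.univ_nonempty fun A : Fin n → {A // A ∈ 𝒜} =>
      ν (prodABFin (fun i => (A i : Matrix (Fin N) (Fin M) ℝ))
          (fun i => (B i : Matrix (Fin M) (Fin N) ℝ)))

/-- The lower minimax joint spectral radius `μ(𝒜,𝒝) = inf_{n ≥ 1} μ_n(𝒜,𝒝)^{1/n}`. -/
noncomputable def muJSR {N M : ℕ} (𝒜 : Finset (Matrix (Fin N) (Fin M) ℝ))
    (𝒝 : Finset (Matrix (Fin M) (Fin N) ℝ)) (hA : 𝒜.Nonempty) (hB : 𝒝.Nonempty)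
    (ν : Matrix (Fin N) (Fin N) ℝ → ℝ) : ℝ :=
  ⨅ n : ℕ, muN 𝒜 𝒝 hA hB ν (n + 1) ^ (1 / ((n : ℝ) + 1))

/-- The upper minimax joint spectral radius `η(𝒜,𝒝) = inf_{n ≥ 1} η_n(𝒜,𝒝)^{1/n}`. -/
noncomputable def etaJSR {N M : ℕ} (𝒜 : Finset (Matrix (Fin N) (Fin M) ℝ))
    (𝒝 : Finset (Matrix (Fin M) (Fin N) ℝ)) (hA : 𝒜.Nonempty) (hB : 𝒝.Nonempty)
    (ν : Matrix (Fin N) (Fin N) ℝ → ℝ) : ℝ :=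
  ⨅ n : ℕ, etaN 𝒜 𝒝 hA hB ν (n + 1) ^ (1 / ((n : ℝ) + 1))

section Products

variable {N M : ℕ}

theorem prodAB_add (A : ℕ → Matrix (Fin N) (Fin M) ℝ) (B : ℕ → Matrix (Fin M) (Fin N) ℝ)
    (m n : ℕ) :
    prodAB A B (m + n) =
      prodAB (fun i => A (m + i)) (fun i => B (m + i)) n * prodAB A B m := by
  induction n with
  | zero => simp [prodAB]
  | succ n ih => rw [← add_assoc, prodAB, prodAB, ih, ← Matrix.mul_assoc]

theorem prodAB_congr {A A' : ℕ → Matrix (Fin N) (Fin M) ℝ}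
    {B B' : ℕ → Matrix (Fin M) (Fin N) ℝ} {n : ℕ}
    (hAA' : ∀ i < n, A i = A' i) (hBB' : ∀ i < n, B i = B' i) :
    prodAB A B n = prodAB A' B' n := by
  induction n with
  | zero => rfl
  | succ n ih =>
    rw [prodAB, prodAB, ih (fun i hi => hAA' i (hi.trans n.lt_succ_self))
      (fun i hi => hBB' i (hi.trans n.lt_succ_self)), hAA' n n.lt_succ_self,
      hBB' n n.lt_succ_self]

theorem prodABFin_eq_prodAB (A : ℕ → Matrix (Fin N) (Fin M) ℝ)
    (B : ℕ → Matrix (Fin M) (Fin N) ℝ) (n : ℕ) :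
    prodABFin (fun i : Fin n => A i) (fun i : Fin n => B i) = prodAB A B n := by
  induction n with
  | zero => simp [prodABFin, prodAB]
  | succ n ih =>
    rw [prodAB, ← ih]
    simp [prodABFin, List.ofFn_succ_last, -List.ofFn_succ]

variable {𝒜 : Finset (Matrix (Fin N) (Fin M) ℝ)} {𝒝 : Finset (Matrix (Fin M) (Fin N) ℝ)}
  {ν : Matrix (Fin N) (Fin N) ℝ → ℝ}

theorem muN_lt_iff (hA : 𝒜.Nonempty) (hB : 𝒝.Nonempty) (n : ℕ) (c : ℝ) :
    muN 𝒜 𝒝 hA hB ν n < c ↔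
      ∀ A : ℕ → Matrix (Fin N) (Fin M) ℝ, (∀ i, A i ∈ 𝒜) →
        ∃ B : ℕ → Matrix (Fin M) (Fin N) ℝ, (∀ i, B i ∈ 𝒝) ∧ ν (prodAB A B n) < c := by
  simp only [muN, Finset.sup'_lt_iff, Finset.inf'_lt_iff, Finset.mem_univ, true_and,
    forall_true_left]
  constructor
  · intro h A hAm
    obtain ⟨B, hBc⟩ := h fun i => ⟨A i, hAm i⟩
    refine ⟨fun i => if hi : i < n then B ⟨i, hi⟩ else hB.choose, fun i => ?_, ?_⟩
    · by_cases hi : i < n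
      · simp [hi]
      · simpa [hi] using hB.choose_spec
    · rw [← prodABFin_eq_prodAB]
      simpa using hBc
  · intro h A
    obtain ⟨B, hBm, hBc⟩ := h (fun i => if hi : i < n then A ⟨i, hi⟩ else hA.choose) fun i => by
      by_cases hi : i < n
      · simp [hi]
      · simpa [hi] using hA.choose_spec
    refine ⟨fun i => ⟨B i, hBm i⟩, ?_⟩
    rw [← prodABFin_eq_prodAB] at hBc
    simpa using hBc

theorem muN_nonneg (hA : 𝒜.Nonempty) (hB : 𝒝.Nonempty) (hν : ∀ X, 0 ≤ ν X) (n : ℕ) :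
    0 ≤ muN 𝒜 𝒝 hA hB ν n := by
  by_contra! h
  obtain ⟨B, -, hlt⟩ := (muN_lt_iff hA hB n 0).1 h (fun _ => hA.choose) fun _ => hA.choose_spec
  exact (hν _).not_gt hlt

theorem muJSR_lt_one_iff (hA : 𝒜.Nonempty) (hB : 𝒝.Nonempty) (hν : ∀ X, 0 ≤ ν X) :
    muJSR 𝒜 𝒝 hA hB ν < 1 ↔ ∃ n, muN 𝒜 𝒝 hA hB ν (n + 1) < 1 := by
  constructor
  · intro h
    obtain ⟨n, hn⟩ := exists_lt_of_ciInf_lt h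
    refine ⟨n, ?_⟩
    by_contra! hge
    exact hn.not_ge (Real.one_le_rpow hge (by positivity))
  · rintro ⟨n, hn⟩
    have hbdd : BddBelow (Set.range fun n : ℕ =>
        muN 𝒜 𝒝 hA hB ν (n + 1) ^ (1 / ((n : ℝ) + 1))) :=
      ⟨0, by rintro _ ⟨k, rfl⟩; exact Real.rpow_nonneg (muN_nonneg hA hB hν _) _⟩
    exact (ciInf_le hbdd n).trans_lt
      (Real.rpow_lt_one (muN_nonneg hA hB hν _) hn (by positivity))

theorem exists_norm_prodAB_le_pow (hν : ∀ X, 0 ≤ ν X)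
    (hν_mul : ∀ X Y : Matrix (Fin N) (Fin N) ℝ, ν (X * Y) ≤ ν X * ν Y)
    (𝒜 : Finset (Matrix (Fin N) (Fin M) ℝ)) (𝒝 : Finset (Matrix (Fin M) (Fin N) ℝ)) :
    ∃ K : ℝ, 1 ≤ K ∧ ∀ (A : ℕ → Matrix (Fin N) (Fin M) ℝ)
      (B : ℕ → Matrix (Fin M) (Fin N) ℝ), (∀ i, A i ∈ 𝒜) → (∀ i, B i ∈ 𝒝) →
        ∀ n, ν (prodAB A B n) ≤ K ^ (n + 1) := by
  obtain ⟨C, hC⟩ := ((𝒜 ×ˢ 𝒝).image fun p => ν (p.1 * p.2)).exists_le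
  have hK : (1 : ℝ) ≤ max 1 (max (ν 1) C) := le_max_left _ _
  refine ⟨max 1 (max (ν 1) C), hK, fun A B hAm hBm n => ?_⟩
  induction n with
  | zero => simp [prodAB]
  | succ n ih =>
    rw [prodAB, pow_succ' _ (n + 1)]
    refine (hν_mul _ _).trans (mul_le_mul ?_ ih (hν _) (by positivity))
    refine le_trans (hC _ ?_) ((le_max_right _ _).trans (le_max_right _ _))
    exact Finset.mem_image.2 ⟨(A n, B n), Finset.mk_mem_product (hAm n) (hBm n), rfl⟩

theorem exists_uniform_length {c : ℝ}
    (h : ∀ A : ℕ → Matrix (Fin N) (Fin M) ℝ, (∀ i, A i ∈ 𝒜) →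
      ∃ n, 1 ≤ n ∧ ∃ B : ℕ → Matrix (Fin M) (Fin N) ℝ, (∀ i, B i ∈ 𝒝) ∧
        ν (prodAB A B n) < c) :
    ∃ L, ∀ A : ℕ → Matrix (Fin N) (Fin M) ℝ, (∀ i, A i ∈ 𝒜) →
      ∃ n, 1 ≤ n ∧ n ≤ L ∧ ∃ B : ℕ → Matrix (Fin M) (Fin N) ℝ, (∀ i, B i ∈ 𝒝) ∧
        ν (prodAB A B n) < c := by
  let U : ℕ → Set (ℕ → {A // A ∈ 𝒜}) := fun L =>
    {A | ∃ n, 1 ≤ n ∧ n ≤ L ∧ ∃ B : ℕ → Matrix (Fin M) (Fin N) ℝ, (∀ i, B i ∈ 𝒝) ∧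
      ν (prodAB (fun i => (A i : Matrix (Fin N) (Fin M) ℝ)) B n) < c}
  have hU_open : ∀ L, IsOpen (U L) := by
    refine fun L => isOpen_iff_mem_nhds.2 ?_
    rintro A ⟨n, hn, hnL, B, hBm, hlt⟩
    refine mem_of_superset
      ((PiNat.isOpen_cylinder _ A n).mem_nhds (PiNat.self_mem_cylinder A n)) ?_
    intro A' hA'
    refine ⟨n, hn, hnL, B, hBm, ?_⟩
    rwa [prodAB_congr (fun i hi => congrArg Subtype.val (hA' i hi)) fun _ _ => rfl]
  have hU_cover : Set.univ ⊆ ⋃ L, U L := by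
    intro A _
    obtain ⟨n, hn, B, hB'⟩ := h (fun i => A i) fun i => (A i).2
    exact Set.mem_iUnion.2 ⟨n, n, hn, le_rfl, B, hB'⟩
  have hU_mono : Monotone U := by
    rintro L L' hL A ⟨n, hn, hnL, hB'⟩
    exact ⟨n, hn, hnL.trans hL, hB'⟩
  obtain ⟨L, hL⟩ := isCompact_univ.elim_directed_cover U hU_open hU_cover hU_mono.directed_le
  exact ⟨L, fun A hAm => hL (Set.mem_univ fun i => (⟨A i, hAm i⟩ : {A // A ∈ 𝒜}))⟩

theorem exists_muN_lt_one_of_uniform_length (hA : 𝒜.Nonempty) (hB : 𝒝.Nonempty)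
    (hν : ∀ X, 0 ≤ ν X) (hν_mul : ∀ X Y : Matrix (Fin N) (Fin N) ℝ, ν (X * Y) ≤ ν X * ν Y)
    {L : ℕ} (h : ∀ A : ℕ → Matrix (Fin N) (Fin M) ℝ, (∀ i, A i ∈ 𝒜) →
      ∃ n, 1 ≤ n ∧ n ≤ L ∧ ∃ B : ℕ → Matrix (Fin M) (Fin N) ℝ, (∀ i, B i ∈ 𝒝) ∧
        ν (prodAB A B n) < 1 / 2) :
    ∃ n, muN 𝒜 𝒝 hA hB ν (n + 1) < 1 := by
  obtain ⟨K, hK, hKpow⟩ := exists_norm_prodAB_le_pow hν hν_mul 𝒜 𝒝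
  have hL : (1 : ℝ) ≤ L := by
    obtain ⟨n, hn, hnL, -⟩ := h (fun _ => hA.choose) fun _ => hA.choose_spec
    exact_mod_cast hn.trans hnL
  obtain ⟨ρ, hρ0, hρ1, hρL⟩ : ∃ ρ : ℝ, 0 < ρ ∧ ρ < 1 ∧ 1 / 2 ≤ ρ ^ L := by
    have hx : 1 / (2 * (L : ℝ)) ≤ 1 / 2 := by
      gcongr
      linarith
    have hx0 : 0 < 1 / (2 * (L : ℝ)) := by positivity
    refine ⟨1 + -(1 / (2 * (L : ℝ))), by linarith, by linarith, ?_⟩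
    refine le_trans (le_of_eq ?_) (one_add_mul_le_pow (by linarith) L)
    field_simp
    norm_num
  have key : ∀ (n : ℕ) (A : ℕ → Matrix (Fin N) (Fin M) ℝ), (∀ i, A i ∈ 𝒜) →
      ∃ B : ℕ → Matrix (Fin M) (Fin N) ℝ, (∀ i, B i ∈ 𝒝) ∧
        ν (prodAB A B n) ≤ 2 * K ^ (L + 1) * ρ ^ n := by
    intro n
    induction n using Nat.strong_induction_on with
    | _ n ih =>
      intro A hAm
      rcases lt_or_ge n L with hn | hn
      · refine ⟨fun _ => hB.choose, fun _ => hB.choose_spec, ?_⟩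
        have h1 : K ^ (n + 1) ≤ K ^ (L + 1) := by gcongr
        have h2 : 1 / 2 ≤ ρ ^ n := hρL.trans (pow_le_pow_of_le_one hρ0.le hρ1.le hn.le)
        have h3 : 0 < K ^ (L + 1) := by positivity
        have h4 := hKpow A (fun _ => hB.choose) hAm (fun _ => hB.choose_spec) n
        nlinarith
      · obtain ⟨m, hm, hmL, B₁, hB₁, hlt⟩ := h A hAm
        obtain ⟨B₂, hB₂, hle⟩ := ih (n - m) (by omega) (fun i => A (m + i)) fun i => hAm _
        refine ⟨fun i => if i < m then B₁ i else B₂ (i - m), fun i => ?_, ?_⟩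
        · dsimp only
          split_ifs
          exacts [hB₁ i, hB₂ _]
        · obtain ⟨k, rfl⟩ : ∃ k, n = m + k := ⟨n - m, by omega⟩
          rw [Nat.add_sub_cancel_left] at hle
          rw [prodAB_add, prodAB_congr (A' := A) (B' := B₁) (n := m) (fun _ _ => rfl)
            fun i hi => if_pos hi]
          simp only [Nat.not_lt.2 (Nat.le_add_right m _), if_false, Nat.add_sub_cancel_left]
          have hm' : ν (prodAB A B₁ m) ≤ ρ ^ m :=
            hlt.le.trans (hρL.trans (pow_le_pow_of_le_one hρ0.le hρ1.le hmL))
          calc _ ≤ _ := hν_mul _ _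
            _ ≤ 2 * K ^ (L + 1) * ρ ^ k * ρ ^ m :=
              mul_le_mul hle hm' (hν _) (by positivity)
            _ = _ := by ring
  have hlim : Tendsto (fun n : ℕ => 2 * K ^ (L + 1) * ρ ^ (n + 1)) atTop (nhds 0) := by
    simpa using ((tendsto_pow_atTop_nhds_zero_of_lt_one hρ0.le hρ1).comp
      (tendsto_add_atTop_nat 1)).const_mul (2 * K ^ (L + 1))
  obtain ⟨n, hn⟩ := (hlim.eventually_lt_const one_pos).exists
  refine ⟨n, (muN_lt_iff hA hB _ _).2 fun A hAm => ?_⟩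
  obtain ⟨B, hBm, hle⟩ := key (n + 1) A hAm
  exact ⟨B, hBm, hle.trans_lt hn⟩

theorem exists_tendsto_zero_of_muN_lt_one (hA : 𝒜.Nonempty) (hB : 𝒝.Nonempty)
    (hν : ∀ X, 0 ≤ ν X) (hν_mul : ∀ X Y : Matrix (Fin N) (Fin N) ℝ, ν (X * Y) ≤ ν X * ν Y)
    {m : ℕ} (hm : 0 < m) (h : muN 𝒜 𝒝 hA hB ν m < 1)
    {A : ℕ → Matrix (Fin N) (Fin M) ℝ} (hAm : ∀ i, A i ∈ 𝒜) :
    ∃ B : ℕ → Matrix (Fin M) (Fin N) ℝ, (∀ i, B i ∈ 𝒝) ∧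
      Tendsto (fun n => ν (prodAB A B n)) atTop (nhds 0) := by
  obtain ⟨K, hK, hKpow⟩ := exists_norm_prodAB_le_pow hν hν_mul 𝒜 𝒝
  obtain ⟨r, hr, hr1⟩ := exists_between h
  have hr0 : 0 ≤ r := (muN_nonneg hA hB hν m).trans hr.le
  choose F hF hFr using fun q : ℕ =>
    (muN_lt_iff hA hB m r).1 hr (fun i => A (m * q + i)) fun i => hAm _
  let B : ℕ → Matrix (Fin M) (Fin N) ℝ := fun i => F (i / m) (i % m)
  have hBm : ∀ i, B i ∈ 𝒝 := fun i => hF _ _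
  have hblock : ∀ q, ν (prodAB A B (m * q)) ≤ K * r ^ q := by
    intro q
    induction q with
    | zero => simpa using hKpow A B hAm hBm 0
    | succ q ih =>
      have hBF : ∀ i < m, B (m * q + i) = F q i := fun i hi => by
        simp [B, Nat.mul_add_div hm, Nat.div_eq_of_lt hi, Nat.mod_eq_of_lt hi]
      rw [Nat.mul_succ, prodAB_add, prodAB_congr (fun _ _ => rfl) hBF]
      calc _ ≤ _ := hν_mul _ _
        _ ≤ r * (K * r ^ q) := mul_le_mul (hFr q).le ih (hν _) hr0
        _ = _ := by ring
  have hbound : ∀ n, ν (prodAB A B n) ≤ K ^ (m + 1) * (K * r ^ (n / m)) := by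
    intro n
    conv_lhs => rw [← Nat.div_add_mod n m, prodAB_add]
    refine (hν_mul _ _).trans (mul_le_mul ?_ (hblock _) (hν _) (by positivity))
    refine (hKpow _ _ (fun i => hAm _) (fun i => hBm _) _).trans ?_
    gcongr
    exact (Nat.mod_lt n hm).le
  refine ⟨B, hBm, squeeze_zero (fun _ => hν _) hbound ?_⟩
  simpa using (((tendsto_pow_atTop_nhds_zero_of_lt_one hr0 hr1).comp
    (Nat.tendsto_div_const_atTop hm.ne')).const_mul K).const_mul (K ^ (m + 1))

end Products

/-- **Theorem: path-dependent stabilizability.** Let `ν` be the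
operator norm on `N×N` matrices induced by a vector norm on `ℝ^N` (a norm with
`ν (X*Y) ≤ ν X * ν Y`).  The following are equivalent: for every sequence
`(A_n) ⊆ 𝒜` there is a sequence `(B_n) ⊆ 𝒝` such that
`ν (A_n B_n ⋯ A_1 B_1) → 0` as `n → ∞`  ⟺  `μ(𝒜,𝒝) < 1`. -/
theorem pathDependentStabilizable_iff_muJSR_lt_one {N M : ℕ}
    (𝒜 : Finset (Matrix (Fin N) (Fin M) ℝ))
    (𝒝 : Finset (Matrix (Fin M) (Fin N) ℝ)) (hA : 𝒜.Nonempty) (hB : 𝒝.Nonempty)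
    (ν : Matrix (Fin N) (Fin N) ℝ → ℝ)
    (hν_zero : ∀ X : Matrix (Fin N) (Fin N) ℝ, ν X = 0 ↔ X = 0)
    (hν_smul : ∀ (c : ℝ) (X : Matrix (Fin N) (Fin N) ℝ), ν (c • X) = |c| * ν X)
    (hν_add : ∀ X Y : Matrix (Fin N) (Fin N) ℝ, ν (X + Y) ≤ ν X + ν Y)
    (hν_mul : ∀ X Y : Matrix (Fin N) (Fin N) ℝ, ν (X * Y) ≤ ν X * ν Y) :
    (∀ A : ℕ → Matrix (Fin N) (Fin M) ℝ, (∀ n, A n ∈ 𝒜) →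
        ∃ B : ℕ → Matrix (Fin M) (Fin N) ℝ, (∀ n, B n ∈ 𝒝) ∧
          Filter.Tendsto (fun n => ν (prodAB A B n)) atTop (nhds 0)) ↔
      muJSR 𝒜 𝒝 hA hB ν < 1 := by
  have hν : ∀ X, 0 ≤ ν X := fun X => by
    have h1 := hν_add X ((-1 : ℝ) • X)
    have h2 : X + (-1 : ℝ) • X = 0 := by simp
    rw [h2, (hν_zero 0).2 rfl, hν_smul, abs_neg, abs_one] at h1
    linarith
  rw [muJSR_lt_one_iff hA hB hν]
  constructor
  · intro h
    obtain ⟨L, hL⟩ := exists_uniform_length (𝒜 := 𝒜) (𝒝 := 𝒝) (ν := ν) (c := 1 / 2)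
      fun A hAm => by
        obtain ⟨B, hBm, hlim⟩ := h A hAm
        obtain ⟨n, hlt, hn⟩ := ((hlim.eventually_lt_const (by norm_num : (0 : ℝ) < 1 / 2)).and
          (eventually_ge_atTop 1)).exists
        exact ⟨n, hn, B, hBm, hlt⟩
    exact exists_muN_lt_one_of_uniform_length hA hB hν hν_mul hL
  · rintro ⟨n, hn⟩ A hAm
    exact exists_tendsto_zero_of_muN_lt_one hA hB hν hν_mul n.succ_pos hn hAm
end

section
/- The following are equivalent: (i) for every sequence (A_n)_{n≥1} with A_n ∈ 𝒜, every sequence (B_n)_{n≥1} with B_n ∈ 𝒝, and every x(0) ∈ ℝ^N, the vectors A_n B_n ⋯ A_1 B_1 x(0) converge to 0 as n → ∞ (asymptotic stability of the controlled system in the class of all perturbations and controls); (ii) ρ(𝒜𝒝) < 1, where 𝒜𝒝 = {AB : A ∈ 𝒜, B ∈ 𝒝}. -/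
open Filter

/-- The product `A_n ⋯ A_1` of the first `n` factors of a sequence of square
matrices (the factor with index `i`, `1 ≤ i ≤ n`, being `A (i-1)`). -/
def prodA {N : ℕ} (A : ℕ → Matrix (Fin N) (Fin N) ℝ) : ℕ → Matrix (Fin N) (Fin N) ℝ
  | 0 => 1
  | n + 1 => A n * prodA A n

/-- The product `A_n ⋯ A_1` for a collection of square matrices indexed by `Fin n`. -/
def prodAFin {N n : ℕ} (A : Fin n → Matrix (Fin N) (Fin N) ℝ) : Matrix (Fin N) (Fin N) ℝ :=
  (List.ofFn A).reverse.prod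

/-- The joint spectral radius `ρ(𝒜) = inf_{n ≥ 1} (max_{A_i ∈ 𝒜} ν (A_n ⋯ A_1))^{1/n}`,
computed with respect to a norm `ν` on `N×N` matrices. -/
noncomputable def jointSR {N : ℕ} (𝒜 : Finset (Matrix (Fin N) (Fin N) ℝ)) (hA : 𝒜.Nonempty)
    (ν : Matrix (Fin N) (Fin N) ℝ → ℝ) : ℝ :=
  haveI : Nonempty {A // A ∈ 𝒜} := ⟨⟨hA.choose, hA.choose_spec⟩⟩
  ⨅ n : ℕ,
    (Finset.univ.sup' Finset.univ_nonempty fun A : Fin (n + 1) → {A // A ∈ 𝒜} =>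
        ν (prodAFin fun i => (A i : Matrix (Fin N) (Fin N) ℝ))) ^ (1 / ((n : ℝ) + 1))

/-- The lower spectral radius `ρ̌(𝒜) = inf_{n ≥ 1} (min_{A_i ∈ 𝒜} ν (A_n ⋯ A_1))^{1/n}`,
computed with respect to a norm `ν` on `N×N` matrices. -/
noncomputable def lowerSR {N : ℕ} (𝒜 : Finset (Matrix (Fin N) (Fin N) ℝ)) (hA : 𝒜.Nonempty)
    (ν : Matrix (Fin N) (Fin N) ℝ → ℝ) : ℝ :=
  haveI : Nonempty {A // A ∈ 𝒜} := ⟨⟨hA.choose, hA.choose_spec⟩⟩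
  ⨅ n : ℕ,
    (Finset.univ.inf' Finset.univ_nonempty fun A : Fin (n + 1) → {A // A ∈ 𝒜} =>
        ν (prodAFin fun i => (A i : Matrix (Fin N) (Fin N) ℝ))) ^ (1 / ((n : ℝ) + 1))

section Products

variable {N : ℕ}

lemma prodA_add (s : ℕ → Matrix (Fin N) (Fin N) ℝ) (j n : ℕ) :
    prodA s (j + n) = prodA (fun k => s (j + k)) n * prodA s j := by
  induction n with
  | zero => simp [prodA]
  | succ n ih => rw [← add_assoc, prodA, ih, prodA, mul_assoc]

lemma prodAFin_eq_prodA (s : ℕ → Matrix (Fin N) (Fin N) ℝ) (n : ℕ) :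
    prodAFin (fun i : Fin n => s i) = prodA s n := by
  induction n with
  | zero => simp [prodAFin, prodA]
  | succ n ih =>
    rw [prodA, ← ih, prodAFin, prodAFin, List.ofFn_succ_last]
    simp

lemma prodAB_eq_prodA {M : ℕ} (A : ℕ → Matrix (Fin N) (Fin M) ℝ)
    (B : ℕ → Matrix (Fin M) (Fin N) ℝ) (n : ℕ) :
    prodAB A B n = prodA (fun k => A k * B k) n := by
  induction n with
  | zero => rfl
  | succ n ih => rw [prodAB, prodA, ih]

lemma continuous_prodA {X : Type*} [TopologicalSpace X]
    {s : X → ℕ → Matrix (Fin N) (Fin N) ℝ} (hs : ∀ k, Continuous fun x => s x k) (n : ℕ) :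
    Continuous fun x => prodA (s x) n := by
  induction n with
  | zero => exact continuous_const
  | succ n ih => exact (hs n).matrix_mul ih

end Products

section MatrixNorm

variable {N : ℕ} {ν : Matrix (Fin N) (Fin N) ℝ → ℝ}

lemma matrixNorm_nonneg (hν_smul : ∀ (c : ℝ) (X : Matrix (Fin N) (Fin N) ℝ), ν (c • X) = |c| * ν X)
    (hν_add : ∀ X Y : Matrix (Fin N) (Fin N) ℝ, ν (X + Y) ≤ ν X + ν Y)
    (X : Matrix (Fin N) (Fin N) ℝ) : 0 ≤ ν X := by
  have h0 := hν_smul 0 X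
  have hneg := hν_smul (-1) X
  have hadd := hν_add X ((-1 : ℝ) • X)
  have hX : X + (-1 : ℝ) • X = (0 : ℝ) • X := by simp
  rw [hX, h0, hneg] at hadd
  simp only [abs_zero, zero_mul, abs_neg, abs_one, one_mul] at hadd
  linarith

/-- A norm on matrices, assumed only to be absolutely homogeneous and subadditive,
as a seminorm on the space of matrices. -/
def matrixSeminorm (ν : Matrix (Fin N) (Fin N) ℝ → ℝ)
    (hν_smul : ∀ (c : ℝ) (X : Matrix (Fin N) (Fin N) ℝ), ν (c • X) = |c| * ν X)
    (hν_add : ∀ X Y : Matrix (Fin N) (Fin N) ℝ, ν (X + Y) ≤ ν X + ν Y) :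
    Seminorm ℝ (Matrix (Fin N) (Fin N) ℝ) :=
  Seminorm.of ν hν_add fun c X => hν_smul c X

lemma matrixNorm_continuous
    (hν_smul : ∀ (c : ℝ) (X : Matrix (Fin N) (Fin N) ℝ), ν (c • X) = |c| * ν X)
    (hν_add : ∀ X Y : Matrix (Fin N) (Fin N) ℝ, ν (X + Y) ≤ ν X + ν Y) : Continuous ν := by
  let p := matrixSeminorm ν hν_smul hν_add
  have hle : ∀ X, p X ≤ ∑ i, ∑ j, |X i j| * p (Matrix.single i j 1) := by
    intro X
    conv_lhs => rw [Matrix.matrix_eq_sum_single X]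
    refine (Finset.le_sum_of_subadditive p (map_zero p).le (map_add_le_add p) _ _).trans
      (Finset.sum_le_sum fun i _ =>
        (Finset.le_sum_of_subadditive p (map_zero p).le (map_add_le_add p) _ _).trans
          (Finset.sum_le_sum fun j _ => ?_))
    have : Matrix.single i j (X i j) = X i j • Matrix.single i j (1 : ℝ) := by simp
    rw [this, map_smul_eq_mul, Real.norm_eq_abs]
  have hcont : Continuous fun X : Matrix (Fin N) (Fin N) ℝ =>
      ∑ i, ∑ j, |X i j| * p (Matrix.single i j 1) :=
    continuous_finsetSum _ fun i _ => continuous_finsetSum _ fun j _ =>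
      (continuous_id.matrix_elem i j).abs.mul continuous_const
  have hzero : Tendsto p (nhds 0) (nhds 0) :=
    squeeze_zero (fun X => apply_nonneg p X) hle (by simpa using hcont.tendsto 0)
  refine continuous_iff_continuousAt.2 fun X => tendsto_iff_norm_sub_tendsto_zero.2 ?_
  have hsub : Tendsto (fun Y => Y - X) (nhds X) (nhds 0) := by
    simpa using ((continuous_id (X := Matrix (Fin N) (Fin N) ℝ)).tendsto X).sub_const X
  exact squeeze_zero (fun _ => norm_nonneg _) (fun Y => abs_sub_map_le_sub p Y X)
    (hzero.comp hsub)

lemma tendsto_mulVec_zero_of_matrixNorm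
    (hν_zero : ∀ X : Matrix (Fin N) (Fin N) ℝ, ν X = 0 ↔ X = 0)
    (hν_smul : ∀ (c : ℝ) (X : Matrix (Fin N) (Fin N) ℝ), ν (c • X) = |c| * ν X)
    (hν_add : ∀ X Y : Matrix (Fin N) (Fin N) ℝ, ν (X + Y) ≤ ν X + ν Y)
    (hν_mul : ∀ X Y : Matrix (Fin N) (Fin N) ℝ, ν (X * Y) ≤ ν X * ν Y)
    {P : ℕ → Matrix (Fin N) (Fin N) ℝ} (hP : Tendsto (fun n => ν (P n)) atTop (nhds 0))
    (x : Fin N → ℝ) : Tendsto (fun n => (P n).mulVec x) atTop (nhds 0) := by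
  have hnonneg := matrixNorm_nonneg hν_smul hν_add
  have hentry : ∀ i j, Tendsto (fun n => P n i j) atTop (nhds 0) := by
    intro i j
    set E : Fin N → Fin N → Matrix (Fin N) (Fin N) ℝ := fun i j => Matrix.single i j 1
    have hEpos : 0 < ν (E i j) := by
      refine (hnonneg _).lt_of_ne' fun h => ?_
      have := congrFun (congrFun ((hν_zero _).1 h) i) j
      simp [E] at this
    have hbound : ∀ n, |P n i j| ≤ ν (E i i) * ν (P n) * ν (E j j) / ν (E i j) := by
      intro n
      have hmul : E i i * P n * E j j = P n i j • E i j := by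
        simp [E, Matrix.single_mul_mul_single]
      rw [le_div_iff₀ hEpos, ← hν_smul, ← hmul]
      exact (hν_mul _ _).trans (mul_le_mul_of_nonneg_right (hν_mul _ _) (hnonneg _))
    refine squeeze_zero_norm hbound ?_
    simpa using ((hP.const_mul (ν (E i i))).mul_const (ν (E j j))).div_const (ν (E i j))
  refine tendsto_pi_nhds.2 fun i => ?_
  simpa [Matrix.mulVec, dotProduct] using
    tendsto_finsetSum Finset.univ fun j _ => (hentry i j).mul_const (x j)

end MatrixNorm

section UniformContraction

variable {N : ℕ} {ν : Matrix (Fin N) (Fin N) ℝ → ℝ}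

lemma exists_bound_prodA (hν_nonneg : ∀ X, 0 ≤ ν X)
    (hν_mul : ∀ X Y : Matrix (Fin N) (Fin N) ℝ, ν (X * Y) ≤ ν X * ν Y)
    (𝒞 : Finset (Matrix (Fin N) (Fin N) ℝ)) (K : ℕ) :
    ∃ D, ∀ n ≤ K, ∀ s : ℕ → Matrix (Fin N) (Fin N) ℝ, (∀ k, s k ∈ 𝒞) → ν (prodA s n) ≤ D := by
  have hle : ∀ C ∈ 𝒞, ν C ≤ 1 + ∑ C ∈ 𝒞, ν C := fun C hC =>
    (Finset.single_le_sum (fun X _ => hν_nonneg X) hC).trans (by simp)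
  have hone : 1 ≤ 1 + ∑ C ∈ 𝒞, ν C := by
    simpa using Finset.sum_nonneg fun X (_ : X ∈ 𝒞) => hν_nonneg X
  have hpow : ∀ (n : ℕ) (s : ℕ → Matrix (Fin N) (Fin N) ℝ), (∀ k, s k ∈ 𝒞) →
      ν (prodA s n) ≤ (1 + ∑ C ∈ 𝒞, ν C) ^ n * ν 1 := by
    intro n s hs
    induction n with
    | zero => simp [prodA]
    | succ n ih =>
      rw [pow_succ', mul_assoc]
      exact (hν_mul _ _).trans
        (mul_le_mul (hle _ (hs n)) ih (hν_nonneg _) (zero_le_one.trans hone))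
  exact ⟨(1 + ∑ C ∈ 𝒞, ν C) ^ K * ν 1, fun n hn s hs => (hpow n s hs).trans
    (mul_le_mul_of_nonneg_right (pow_le_pow_right₀ hone hn) (hν_nonneg 1))⟩

/-- If every sequence of factors has a prefix of positive length at most `K` on which the norm of
the product is at most `q`, then long products decay geometrically, uniformly over all sequences. -/
lemma exists_prodA_le_mul_pow (hν_nonneg : ∀ X, 0 ≤ ν X)
    (hν_mul : ∀ X Y : Matrix (Fin N) (Fin N) ℝ, ν (X * Y) ≤ ν X * ν Y)
    {𝒞 : Finset (Matrix (Fin N) (Fin N) ℝ)} {K : ℕ} {q : ℝ} (hq : q ≤ 1)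
    (h : ∀ s : ℕ → Matrix (Fin N) (Fin N) ℝ, (∀ k, s k ∈ 𝒞) →
      ∃ j, 0 < j ∧ j ≤ K ∧ ν (prodA s j) ≤ q) :
    ∃ D, ∀ (m n : ℕ) (s : ℕ → Matrix (Fin N) (Fin N) ℝ), (∀ k, s k ∈ 𝒞) → m * K ≤ n →
      ν (prodA s n) ≤ D * q ^ m := by
  obtain ⟨D, hD⟩ := exists_bound_prodA hν_nonneg hν_mul 𝒞 K
  have hsplit : ∀ (n j : ℕ) (s : ℕ → Matrix (Fin N) (Fin N) ℝ), j ≤ n →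
      ν (prodA s n) ≤ ν (prodA (fun k => s (j + k)) (n - j)) * ν (prodA s j) := by
    intro n j s hj
    conv_lhs => rw [← Nat.add_sub_cancel' hj, prodA_add]
    exact hν_mul _ _
  refine ⟨D, fun m => ?_⟩
  induction m with
  | zero =>
    intro n
    induction n using Nat.strong_induction_on with
    | _ n ih =>
      intro s hs _
      rcases le_total n K with hn | hn
      · simpa using hD n hn s hs
      · obtain ⟨j, hj0, hjK, hj⟩ := h s hs
        have hrest := ih (n - j) (by omega) (fun k => s (j + k)) (fun k => hs _) (by omega)
        exact (hsplit n j s (hjK.trans hn)).trans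
          ((mul_le_of_le_one_right (hν_nonneg _) (hj.trans hq)).trans hrest)
  | succ m ih =>
    intro n s hs hn
    obtain ⟨j, -, hjK, hj⟩ := h s hs
    rw [add_mul, one_mul] at hn
    have hrest := ih (n - j) (fun k => s (j + k)) (fun k => hs _) (by omega)
    rw [pow_succ, ← mul_assoc]
    exact (hsplit n j s (by omega)).trans
      (mul_le_mul hrest hj (hν_nonneg _) ((hν_nonneg _).trans hrest))

/-- By compactness of the space of sequences of factors, prefixes with small product
can be chosen of uniformly bounded length. -/
lemma exists_uniform_prefix_length (hν_cont : Continuous ν)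
    {𝒞 : Finset (Matrix (Fin N) (Fin N) ℝ)} {q : ℝ}
    (h : ∀ s : ℕ → Matrix (Fin N) (Fin N) ℝ, (∀ k, s k ∈ 𝒞) →
      ∃ j, 0 < j ∧ ν (prodA s j) < q) :
    ∃ K, ∀ s : ℕ → Matrix (Fin N) (Fin N) ℝ, (∀ k, s k ∈ 𝒞) →
      ∃ j, 0 < j ∧ j ≤ K ∧ ν (prodA s j) < q := by
  let val : (ℕ → {C // C ∈ 𝒞}) → ℕ → Matrix (Fin N) (Fin N) ℝ := fun s k => s k
  let U : ℕ → Set (ℕ → {C // C ∈ 𝒞}) :=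
    fun K => ⋃ j ∈ Set.Ioc 0 K, {s | ν (prodA (val s) j) < q}
  have hU : ∀ K, IsOpen (U K) := fun K => isOpen_biUnion fun j _ =>
    isOpen_lt (hν_cont.comp (continuous_prodA
      (fun k => continuous_subtype_val.comp (continuous_apply k)) j)) continuous_const
  have hmono : Monotone U := fun K L hKL =>
    Set.biUnion_subset_biUnion_left (Set.Ioc_subset_Ioc_right hKL)
  have hcover : Set.univ ⊆ ⋃ K, U K := by
    intro s _
    obtain ⟨j, hj0, hj⟩ := h (val s) fun k => (s k).2
    exact Set.mem_iUnion.2 ⟨j, Set.mem_biUnion (x := j) ⟨hj0, le_rfl⟩ hj⟩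
  obtain ⟨K, hK⟩ := isCompact_univ.elim_directed_cover U hU hcover hmono.directed_le
  refine ⟨K, fun s hs => ?_⟩
  have hsK := hK (Set.mem_univ fun k => (⟨s k, hs k⟩ : {C // C ∈ 𝒞}))
  obtain ⟨j, hj, hjq⟩ := Set.mem_iUnion₂.1 hsK
  exact ⟨j, hj.1, hj.2, hjq⟩

end UniformContraction

lemma jointSR_lt_one_iff {N : ℕ} {ν : Matrix (Fin N) (Fin N) ℝ → ℝ} (hν_nonneg : ∀ X, 0 ≤ ν X)
    {𝒞 : Finset (Matrix (Fin N) (Fin N) ℝ)} (hC : 𝒞.Nonempty) :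
    jointSR 𝒞 hC ν < 1 ↔ ∃ n : ℕ, ∃ q < 1, ∀ s : ℕ → Matrix (Fin N) (Fin N) ℝ,
      (∀ k, s k ∈ 𝒞) → ν (prodA s (n + 1)) ≤ q := by
  have : Nonempty {C // C ∈ 𝒞} := ⟨⟨hC.choose, hC.choose_spec⟩⟩
  have hsup_nonneg : ∀ n : ℕ, 0 ≤ Finset.univ.sup' Finset.univ_nonempty
      fun A : Fin (n + 1) → {C // C ∈ 𝒞} =>
        ν (prodAFin fun i => (A i : Matrix (Fin N) (Fin N) ℝ)) := fun n =>
    (hν_nonneg _).trans (Finset.le_sup' (fun A : Fin (n + 1) → {C // C ∈ 𝒞} =>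
      ν (prodAFin fun i => (A i : Matrix (Fin N) (Fin N) ℝ)))
      (Finset.mem_univ (Classical.arbitrary _)))
  constructor
  · intro h
    obtain ⟨n, hn⟩ := exists_lt_of_ciInf_lt h
    refine ⟨n, _, lt_of_not_ge fun h1 => hn.not_ge (Real.one_le_rpow h1 (by positivity)),
      fun s hs => ?_⟩
    rw [← prodAFin_eq_prodA]
    exact Finset.le_sup' (fun A : Fin (n + 1) → {C // C ∈ 𝒞} =>
      ν (prodAFin fun i => (A i : Matrix (Fin N) (Fin N) ℝ)))
      (Finset.mem_univ fun i : Fin (n + 1) => (⟨s i, hs i⟩ : {C // C ∈ 𝒞}))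
  · rintro ⟨n, q, hq, h⟩
    refine (ciInf_le ⟨0, ?_⟩ n).trans_lt
      (Real.rpow_lt_one (hsup_nonneg n) (lt_of_le_of_lt ?_ hq) (by positivity))
    · rintro _ ⟨m, rfl⟩
      exact Real.rpow_nonneg (hsup_nonneg m) _
    · refine Finset.sup'_le _ _ fun A _ => ?_
      have hs := h (fun k => A (Fin.ofNat (n + 1) k)) fun k => (A _).2
      rw [← prodAFin_eq_prodA] at hs
      simpa using hs

/-- **asymptotic stability of the controlled system.** Let `ν` be
the operator norm on `N×N` matrices induced by a vector norm on `ℝ^N` (a norm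
with `ν (X*Y) ≤ ν X * ν Y`).  The following are equivalent: for every sequence
`(A_n) ⊆ 𝒜`, every sequence `(B_n) ⊆ 𝒝` and every `x(0) ∈ ℝ^N` the vectors
`A_n B_n ⋯ A_1 B_1 x(0)` converge to `0`  ⟺  `ρ(𝒜𝒝) < 1`, where
`𝒜𝒝 = {A * B : A ∈ 𝒜, B ∈ 𝒝}`. -/
theorem controlledAsymptoticallyStable_iff_jointSR_mul_lt_one {N M : ℕ}
    (𝒜 : Finset (Matrix (Fin N) (Fin M) ℝ))
    (𝒝 : Finset (Matrix (Fin M) (Fin N) ℝ)) (hA : 𝒜.Nonempty) (hB : 𝒝.Nonempty)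
    (ν : Matrix (Fin N) (Fin N) ℝ → ℝ)
    (hν_zero : ∀ X : Matrix (Fin N) (Fin N) ℝ, ν X = 0 ↔ X = 0)
    (hν_smul : ∀ (c : ℝ) (X : Matrix (Fin N) (Fin N) ℝ), ν (c • X) = |c| * ν X)
    (hν_add : ∀ X Y : Matrix (Fin N) (Fin N) ℝ, ν (X + Y) ≤ ν X + ν Y)
    (hν_mul : ∀ X Y : Matrix (Fin N) (Fin N) ℝ, ν (X * Y) ≤ ν X * ν Y) :
    (∀ A : ℕ → Matrix (Fin N) (Fin M) ℝ, (∀ n, A n ∈ 𝒜) →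
        ∀ B : ℕ → Matrix (Fin M) (Fin N) ℝ, (∀ n, B n ∈ 𝒝) →
          ∀ x₀ : Fin N → ℝ,
            Filter.Tendsto (fun n => (prodAB A B n).mulVec x₀) atTop (nhds 0)) ↔
      jointSR (Finset.image₂ (· * ·) 𝒜 𝒝) (hA.image₂ hB) ν < 1 := by
  have hnonneg := matrixNorm_nonneg hν_smul hν_add
  have hcont := matrixNorm_continuous hν_smul hν_add
  rw [jointSR_lt_one_iff hnonneg]
  constructor
  · intro h
    have hprefix : ∀ s : ℕ → Matrix (Fin N) (Fin N) ℝ,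
        (∀ k, s k ∈ Finset.image₂ (· * ·) 𝒜 𝒝) → ∃ j, 0 < j ∧ ν (prodA s j) < 1 / 2 := by
      intro s hs
      choose A hA' B hB' hAB using fun k => Finset.mem_image₂.1 (hs k)
      have hprod : ∀ n, prodAB A B n = prodA s n := fun n => by
        rw [prodAB_eq_prodA]
        exact congrArg (prodA · n) (funext hAB)
      have hlim : Tendsto (fun n => prodA s n) atTop (nhds 0) := by
        refine tendsto_pi_nhds.2 fun i => tendsto_pi_nhds.2 fun j => ?_
        simpa [hprod] using tendsto_pi_nhds.1 (h A hA' B hB' (Pi.single j 1)) i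
      have hnorm := (hcont.tendsto 0).comp hlim
      rw [(hν_zero 0).2 rfl] at hnorm
      exact ((eventually_gt_atTop 0).and
        (hnorm.eventually_lt_const (by norm_num : (0 : ℝ) < 1 / 2))).exists
    obtain ⟨K, hK⟩ := exists_uniform_prefix_length hcont hprefix
    obtain ⟨D, hD⟩ := exists_prodA_le_mul_pow hnonneg hν_mul (q := 1 / 2) (by norm_num)
      fun s hs => (hK s hs).imp fun j hj => ⟨hj.1, hj.2.1, hj.2.2.le⟩
    have hlim : Tendsto (fun m : ℕ => D * (1 / 2 : ℝ) ^ m) atTop (nhds 0) := by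
      simpa using (tendsto_pow_atTop_nhds_zero_of_lt_one
        (by norm_num : (0 : ℝ) ≤ 1 / 2) (by norm_num)).const_mul D
    obtain ⟨m, hm⟩ := (hlim.eventually_lt_const one_pos).exists
    exact ⟨m * K, _, hm, fun s hs => hD m _ s hs (Nat.le_succ _)⟩
  · rintro ⟨K, q, hq, h⟩ A hA' B hB' x₀
    have hs : ∀ k, A k * B k ∈ Finset.image₂ (· * ·) 𝒜 𝒝 := fun k =>
      Finset.mem_image₂_of_mem (hA' k) (hB' k)
    have hq0 : 0 ≤ q := (hnonneg _).trans (h _ hs)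
    obtain ⟨D, hD⟩ := exists_prodA_le_mul_pow hnonneg hν_mul hq.le
      fun s hs => ⟨K + 1, Nat.succ_pos K, le_rfl, h s hs⟩
    refine tendsto_mulVec_zero_of_matrixNorm hν_zero hν_smul hν_add hν_mul ?_ x₀
    have hlim : Tendsto (fun n : ℕ => D * q ^ (n / (K + 1))) atTop (nhds 0) := by
      simpa using ((tendsto_pow_atTop_nhds_zero_of_lt_one hq0 hq).comp
        (Nat.tendsto_div_const_atTop K.succ_ne_zero)).const_mul D
    refine squeeze_zero (fun n => hnonneg _) (fun n => ?_) hlim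
    rw [prodAB_eq_prodA]
    exact hD _ n _ hs (Nat.div_mul_le_self n (K + 1))
end
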